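/- arXiv:0910.4511 — 3 statements merged into one kernel-verified Lean document; each statement's English description precedes it below -/
import Mathlib

section
/- For a weakly C(4) finite monoid presentation ⟨A | R⟩: let p₁ and p₂ be pieces and u, v words. If p₁·u ≡ p₁·v and u is p₂-active, then p₂·u ≡ p₂·v. -/
open List

/-- A *relation word* is a word occurring as one side of some relation in `R`. -/
def RelWord {A : Type*} (R : Finset (List A × List A)) (w : List A) : Prop :=
  ∃ p ∈ R, w = p.1 ∨ w = p.2

/-- One elementary rewriting step using a defining relation (in either direction). -/
def OneStep {A : Type*} (R : Finset (List A × List A)) (u v : List A) : Prop :=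
  ∃ l r x y, ((x, y) ∈ R ∨ (y, x) ∈ R) ∧ u = l ++ x ++ r ∧ v = l ++ y ++ r

/-- `u ≡ v`: the congruence on the free monoid `A*` generated by the relations `R`. -/
def MEquiv {A : Type*} (R : Finset (List A × List A)) : List A → List A → Prop :=
  Relation.ReflTransGen (OneStep R)

/-- A *piece*: a word occurring as a factor of two distinct relation words, or in two
different (possibly overlapping) positions within one relation word.  The empty word
is a piece. -/
def Piece {A : Type*} (R : Finset (List A × List A)) (p : List A) : Prop :=
  p = [] ∨ ∃ r₁ r₂ a₁ b₁ a₂ b₂, RelWord R r₁ ∧ RelWord R r₂ ∧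
    r₁ = a₁ ++ p ++ b₁ ∧ r₂ = a₂ ++ p ++ b₂ ∧ (r₁ ≠ r₂ ∨ a₁ ≠ a₂)

/-- Weakly `C(n)`: no relation word is a product of strictly fewer than `n` pieces. -/
def WeaklyC {A : Type*} (R : Finset (List A × List A)) (n : ℕ) : Prop :=
  ∀ w, RelWord R w → ∀ L : List (List A), (∀ p ∈ L, Piece R p) → w = L.flatten →
    n ≤ L.length

/-- `X` is the maximal (longest) prefix of `r` which is a piece. -/
def MaxPiecePrefix {A : Type*} (R : Finset (List A × List A)) (r X : List A) : Prop :=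
  X <+: r ∧ Piece R X ∧ ∀ p, p <+: r → Piece R p → p.length ≤ X.length

/-- `Z` is the maximal (longest) suffix of `r` which is a piece. -/
def MaxPieceSuffix {A : Type*} (R : Finset (List A × List A)) (r Z : List A) : Prop :=
  Z <:+ r ∧ Piece R Z ∧ ∀ s, s <:+ r → Piece R s → s.length ≤ Z.length

/-- `X ++ Y ++ Z` is a relation word with maximal piece prefix `X`, middle word `Y`
and maximal piece suffix `Z`. -/
def RelDecomp {A : Type*} (R : Finset (List A × List A)) (X Y Z : List A) : Prop :=
  RelWord R (X ++ Y ++ Z) ∧ MaxPiecePrefix R (X ++ Y ++ Z) X ∧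
    MaxPieceSuffix R (X ++ Y ++ Z) Z

/-- `q` is a relation prefix of `u`: a prefix of the form `a ++ X ++ Y` where `X`, `Y`
are the maximal piece prefix and middle word of some relation word `X ++ Y ++ Z`. -/
def RelPrefix {A : Type*} (R : Finset (List A × List A)) (u q : List A) : Prop :=
  q <+: u ∧ ∃ a X Y Z, q = a ++ X ++ Y ∧ RelDecomp R X Y Z

/-- `a ++ X ++ Y` is an overlap prefix of `u`, with final maximal piece prefix `X` and
middle word `Y`, i.e. it admits a factorisation `b X₁ Y₁' ⋯ X_{n-1} Y_{n-1}' X_n Y_n`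
with `X = X_n`, `Y = Y_n`, no factor `X₀ Y₀` beginning strictly before the end of `b`,
each `X_i Y_i Z_i` a relation word factored into maximal piece prefix, middle word and
maximal piece suffix, and each `Y_i'` (`i < n`) a proper non-empty prefix of `Y_i`. -/
def OPrefix {A : Type*} (R : Finset (List A × List A)) (u a X Y : List A) : Prop :=
  (a ++ X ++ Y) <+: u ∧
  ∃ (b : List A) (n : ℕ) (Xs Ys Zs Ys' : ℕ → List A),
    1 ≤ n ∧ Xs (n - 1) = X ∧ Ys (n - 1) = Y ∧
    a = b ++ ((List.range (n - 1)).map fun i => Xs i ++ Ys' i).flatten ∧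
    (∀ i < n, RelDecomp R (Xs i) (Ys i) (Zs i)) ∧
    (∀ i < n - 1, Ys' i ≠ [] ∧ Ys' i <+: Ys i ∧ Ys' i ≠ Ys i) ∧
    ¬ ∃ c d X₀ Y₀ Z₀, RelDecomp R X₀ Y₀ Z₀ ∧
        a ++ X ++ Y = c ++ X₀ ++ Y₀ ++ d ∧ c.length < b.length

/-- The relation prefix `a ++ X ++ Y` of `u` is *clean*: `u` has no prefix
`a ++ X ++ Y₀ ++ X₁ ++ Y₁` with `Y₀` a proper non-empty prefix of `Y` and `X₁`, `Y₁`
the maximal piece prefix and middle word of some relation word. -/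
def CleanAt {A : Type*} (R : Finset (List A × List A)) (u a X Y : List A) : Prop :=
  ¬ ∃ Y₀ X₁ Y₁ Z₁, RelDecomp R X₁ Y₁ Z₁ ∧ Y₀ ≠ [] ∧ Y₀ <+: Y ∧ Y₀ ≠ Y ∧
      (a ++ X ++ Y₀ ++ X₁ ++ Y₁) <+: u

/-- `a ++ X ++ Y` is a clean overlap prefix of `u`, where `X ++ Y ++ Z` is a relation
word with maximal piece prefix `X`, middle word `Y` and maximal piece suffix `Z`. -/
def CleanOverlapPrefix {A : Type*} (R : Finset (List A × List A))
    (u a X Y Z : List A) : Prop :=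
  RelDecomp R X Y Z ∧ OPrefix R u a X Y ∧ CleanAt R u a X Y

/-- `r'` is a complement of the relation word `r`: there is a chain of relation words
from `r` to `r'` each consecutive pair of which forms a relation (in some order). -/
def RelComplement {A : Type*} (R : Finset (List A × List A)) (r r' : List A) : Prop :=
  RelWord R r ∧ Relation.ReflTransGen (fun s t => (s, t) ∈ R ∨ (t, s) ∈ R) r r'

/-- `u` is `p`-active: `p ++ u` has a relation prefix `a ++ X ++ Y` with `|a| < |p|`. -/
def PActive {A : Type*} (R : Finset (List A × List A)) (p u : List A) : Prop :=
  ∃ a X Y Z, RelDecomp R X Y Z ∧ (a ++ X ++ Y) <+: (p ++ u) ∧ a.length < p.length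

/-- `p` is a possible prefix of `u`: `p ++ w ≡ u` for some word `w`. -/
def PossPrefix {A : Type*} (R : Finset (List A × List A)) (p u : List A) : Prop :=
  ∃ w, MEquiv R (p ++ w) u

section SmallOverlap

variable {A : Type*} {R : Finset (List A × List A)}

theorem Piece.of_factor {a p b : List A} (h : Piece R (a ++ p ++ b)) : Piece R p := by
  rcases h with h | ⟨r₁, r₂, a₁, b₁, a₂, b₂, h₁, h₂, e₁, e₂, h⟩
  · left
    simp_all
  · refine Or.inr ⟨r₁, r₂, a₁ ++ a, b ++ b₁, a₂ ++ a, b ++ b₂, h₁, h₂, ?_, ?_, ?_⟩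
    · simp [e₁]
    · simp [e₂]
    · simpa using h

theorem Piece.of_occurrences {r₁ r₂ p : List A} (a₁ b₁ a₂ b₂ : List A)
    (h₁ : RelWord R r₁) (h₂ : RelWord R r₂) (e₁ : r₁ = a₁ ++ p ++ b₁)
    (e₂ : r₂ = a₂ ++ p ++ b₂) (h : r₁ ≠ r₂ ∨ a₁ ≠ a₂) : Piece R p :=
  Or.inr ⟨r₁, r₂, a₁, b₁, a₂, b₂, h₁, h₂, e₁, e₂, h⟩

theorem RelWord.not_piece {r : List A} (hC : WeaklyC R 4) (h : RelWord R r) : ¬ Piece R r := by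
  intro hp
  have := hC r h [r] (by simpa using hp) (by simp)
  simp at this

theorem RelWord.not_three_pieces {p q s : List A} (hC : WeaklyC R 4)
    (h : RelWord R (p ++ q ++ s)) (hp : Piece R p) (hq : Piece R q) (hs : Piece R s) :
    False := by
  have := hC _ h [p, q, s] (by simp [hp, hq, hs]) (by simp)
  simp at this

theorem RelDecomp.middle_not_piece {X Y Z : List A} (hC : WeaklyC R 4)
    (h : RelDecomp R X Y Z) : ¬ Piece R Y := fun hY =>
  h.1.not_three_pieces hC h.2.1.2.1 hY h.2.2.2.1

theorem RelDecomp.not_piece_of_middle_factor {X Y Z a b : List A} (hC : WeaklyC R 4)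
    (h : RelDecomp R X Y Z) : ¬ Piece R (a ++ Y ++ b) := fun hp =>
  h.middle_not_piece hC hp.of_factor

theorem RelDecomp.piece_suffix_eq_nil {X Y Z y y' : List A} (h : RelDecomp R X Y Z)
    (hy : Y = y ++ y') (hp : Piece R (y' ++ Z)) : y' = [] := by
  have := h.2.2.2.2 (y' ++ Z) ⟨X ++ y, by simp [hy]⟩ hp
  simpa using this

/-- Every relation word has a factorisation into maximal piece prefix, middle word and maximal
piece suffix. -/
theorem RelWord.exists_decomp {r : List A} (hC : WeaklyC R 4) (h : RelWord R r) :
    ∃ X Y Z, r = X ++ Y ++ Z ∧ RelDecomp R X Y Z := by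
  classical
  have hnil : Piece R ([] : List A) := Or.inl rfl
  obtain ⟨i, hi, hpi, hmi⟩ : ∃ i ≤ r.length, Piece R (r.take i) ∧
      ∀ j ≤ r.length, Piece R (r.take j) → j ≤ i := by
    refine ⟨Nat.findGreatest (fun j => Piece R (r.take j)) r.length,
      Nat.findGreatest_le _, ?_, fun j hj hpj => Nat.le_findGreatest hj hpj⟩
    exact Nat.findGreatest_spec (P := fun j => Piece R (r.take j)) (Nat.zero_le _) (by simpa)
  obtain ⟨k, hk, hpk, hmk⟩ : ∃ k ≤ r.length, Piece R (r.drop (r.length - k)) ∧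
      ∀ j ≤ r.length, Piece R (r.drop (r.length - j)) → j ≤ k := by
    refine ⟨Nat.findGreatest (fun j => Piece R (r.drop (r.length - j))) r.length,
      Nat.findGreatest_le _, ?_, fun j hj hpj => Nat.le_findGreatest hj hpj⟩
    exact Nat.findGreatest_spec (P := fun j => Piece R (r.drop (r.length - j)))
      (Nat.zero_le _) (by simpa)
  have hik : i ≤ r.length - k := by
    by_contra! hlt
    have hd : Piece R (r.drop i) := by
      have e : r.drop (r.length - k) =
          (r.drop (r.length - k)).take (i - (r.length - k)) ++ r.drop i ++ [] := by
        conv_lhs => rw [← List.take_append_drop (i - (r.length - k)) (r.drop (r.length - k))]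
        rw [List.drop_drop, List.append_nil]
        congr 2
        omega
      rw [e] at hpk
      exact hpk.of_factor
    exact RelWord.not_three_pieces (p := r.take i) (q := r.drop i) (s := []) hC
      (by simpa using h) hpi hd hnil
  have e : r = r.take i ++ (r.drop i).take (r.length - k - i) ++ r.drop (r.length - k) := by
    have e' : r.drop (r.length - k) = (r.drop i).drop (r.length - k - i) := by
      rw [List.drop_drop]
      congr 1
      omega
    rw [e', List.append_assoc, List.take_append_drop, List.take_append_drop]
  refine ⟨r.take i, (r.drop i).take (r.length - k - i), r.drop (r.length - k), e, ?_⟩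
  unfold RelDecomp
  rw [← e]
  refine ⟨h, ⟨List.take_prefix _ _, hpi, fun p hp hpp => ?_⟩,
    ⟨List.drop_suffix _ _, hpk, fun p hp hpp => ?_⟩⟩
  · rw [List.length_take, min_eq_left hi]
    refine hmi _ hp.length_le ?_
    rwa [← List.prefix_iff_eq_take.1 hp]
  · have hl : (r.drop (r.length - k)).length = k := by
      rw [List.length_drop]
      omega
    rw [hl]
    refine hmk _ hp.length_le ?_
    rwa [← List.suffix_iff_eq_drop.1 hp]

/-- Two factors of relation words which begin together and contain the respective middle words
come from the same position of the same relation word. -/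
theorem RelDecomp.eq_of_common_extension {X Y Z X' Y' Z' a b a' b' s s' : List A}
    (hC : WeaklyC R 4) (h : RelDecomp R X Y Z) (h' : RelDecomp R X' Y' Z')
    (hX : X = a ++ b) (hX' : X' = a' ++ b') (e : b ++ Y ++ s = b' ++ Y' ++ s') :
    X ++ Y ++ Z = X' ++ Y' ++ Z' ∧ a = a' := by
  by_contra hne
  have hne' : X ++ Y ++ Z ≠ X' ++ Y' ++ Z' ∨ a ≠ a' := by tauto
  rcases List.append_eq_append_iff.1 e with ⟨c, hc, -⟩ | ⟨c, hc, -⟩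
  · have : Piece R (b ++ Y ++ []) := Piece.of_occurrences a Z a' (c ++ Z') h.1 h'.1
      (by simp [hX]) (by simp only [hX', append_nil, append_assoc] at hc ⊢; grind) hne'
    exact h.not_piece_of_middle_factor hC this
  · have : Piece R (b' ++ Y' ++ []) := Piece.of_occurrences a (c ++ Z) a' Z' h.1 h'.1
      (by simp only [hX, append_nil, append_assoc] at hc ⊢; grind) (by simp [hX']) hne'
    exact h'.not_piece_of_middle_factor hC this

/-- A rewriting sequence with a given number of elementary steps. -/
inductive RewriteChain (R : Finset (List A × List A)) : ℕ → List A → List A → Prop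
  | refl (u : List A) : RewriteChain R 0 u u
  | head {n : ℕ} {u w v : List A} : OneStep R u w → RewriteChain R n w v → RewriteChain R (n + 1) u v

theorem OneStep.symm {u v : List A} (h : OneStep R u v) : OneStep R v u := by
  obtain ⟨l, r, x, y, hR, hu, hv⟩ := h
  exact ⟨l, r, y, x, hR.symm, hv, hu⟩

theorem OneStep.append_left {u v : List A} (a : List A) (h : OneStep R u v) :
    OneStep R (a ++ u) (a ++ v) := by
  obtain ⟨l, r, x, y, hR, hu, hv⟩ := h
  exact ⟨a ++ l, r, x, y, hR, by simp [hu], by simp [hv]⟩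

theorem MEquiv.append_left {u v : List A} (a : List A) (h : MEquiv R u v) :
    MEquiv R (a ++ u) (a ++ v) :=
  by
  induction h with
  | refl => exact Relation.ReflTransGen.refl
  | tail _ hs ih => exact Relation.ReflTransGen.tail ih (hs.append_left a)

namespace RewriteChain

theorem snoc {n : ℕ} {u w v : List A} (h : RewriteChain R n u w) (hs : OneStep R w v) :
    RewriteChain R (n + 1) u v := by
  induction h with
  | refl => exact head hs (refl _)
  | head h₁ _ ih => exact head h₁ (ih hs)

theorem symm {n : ℕ} {u v : List A} (h : RewriteChain R n u v) : RewriteChain R n v u := by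
  induction h with
  | refl => exact refl _
  | head h₁ _ ih => exact ih.snoc h₁.symm

theorem mequiv {n : ℕ} {u v : List A} (h : RewriteChain R n u v) : MEquiv R u v := by
  induction h with
  | refl => exact Relation.ReflTransGen.refl
  | head h₁ _ ih => exact Relation.ReflTransGen.head h₁ ih

/-- A rewriting sequence is constant, or it never touches the first letter, or at some point it
rewrites a relation word which is a prefix. -/
theorem trichotomy {n : ℕ} {u v : List A} (h : RewriteChain R n u v) :
    (n = 0 ∧ u = v) ∨ (∃ c u' v', u = c :: u' ∧ v = c :: v' ∧ RewriteChain R n u' v') ∨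
      ∃ x t i, i < n ∧ RelWord R x ∧ RewriteChain R i u (x ++ t) := by
  induction h with
  | refl => exact Or.inl ⟨rfl, rfl⟩
  | @head n u w v hs hc ih =>
    right
    obtain ⟨l, r, x, y, hR, hu, hw⟩ := id hs
    rcases l with _ | ⟨c, l⟩
    · right
      refine ⟨x, r, 0, Nat.succ_pos _, ?_, by rw [hu]; exact refl _⟩
      rcases hR with hR | hR
      · exact ⟨_, hR, Or.inl rfl⟩
      · exact ⟨_, hR, Or.inr rfl⟩
    · have hs' : OneStep R (l ++ x ++ r) (l ++ y ++ r) := ⟨l, r, x, y, hR, rfl, rfl⟩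
      rcases ih with ⟨rfl, rfl⟩ | ⟨c', w', v', hw', hv', hc'⟩ | ⟨x', t, i, hi, hx', hc'⟩
      · left
        exact ⟨c, _, _, hu, hw, head hs' (refl _)⟩
      · left
        rw [hw'] at hw
        simp only [List.cons_append, List.cons.injEq] at hw
        obtain ⟨rfl, rfl⟩ := hw
        exact ⟨c', _, v', hu, hv', head hs' hc'⟩
      · exact Or.inr ⟨x', t, i + 1, by omega, hx', head hs hc'⟩

end RewriteChain

theorem MEquiv.exists_chain {u v : List A} (h : MEquiv R u v) : ∃ n, RewriteChain R n u v := by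
  induction h with
  | refl => exact ⟨0, .refl _⟩
  | tail _ hs ih =>
    obtain ⟨n, hn⟩ := ih
    exact ⟨n + 1, hn.snoc hs⟩

/-- The words `u` and `v` agree, or after removal of a common prefix they are congruent and the
remainder of `u` begins with the maximal piece prefix and middle word of a relation word. -/
def AgreeOrSplit (R : Finset (List A × List A)) (u v : List A) : Prop :=
  u = v ∨ ∃ a u' v' X Y Z s, u = a ++ u' ∧ v = a ++ v' ∧ MEquiv R u' v' ∧
    RelDecomp R X Y Z ∧ u' = X ++ Y ++ s

/-- If the suffix `Z` of a relation word can be rewritten away, no relation word occurs starting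
strictly inside its middle word. -/
theorem no_occurrence_inside_middle {X Y Z y y' x s t h : List A} (hC : WeaklyC R 4)
    (hd : RelDecomp R X Y Z) (hy : Y = y ++ y') (hy₀ : y ≠ []) (hy' : y' ≠ [])
    (hx : RelWord R x) (e : y' ++ s = x ++ h) (hs : AgreeOrSplit R s (Z ++ t)) : False := by
  have hr : X ++ Y ++ Z = (X ++ y) ++ y' ++ Z := by simp [hy]
  have hxy : X ++ y ≠ [] := by simp [hy₀]
  obtain ⟨X₁, Y₁, Z₁, rfl, hd₁⟩ := hx.exists_decomp hC
  have piece_of : ∀ p b b₁, y' ++ Z = p ++ b → X₁ ++ Y₁ ++ Z₁ = p ++ b₁ → Piece R p := by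
    intro p b b₁ e₁ e₂
    exact Piece.of_occurrences (X ++ y) b [] b₁ hd.1 hx (by simp [hy, e₁]) (by simpa using e₂)
      (Or.inr hxy)
  -- the occurring relation word extends beyond the middle word, which ends inside `X₁`
  obtain ⟨x₁, hx₁⟩ : ∃ x₁, X₁ = y' ++ x₁ := by
    rcases List.append_eq_append_iff.1 e with ⟨c, hc, -⟩ | ⟨c, hc, -⟩
    · have hp : Piece R y' := piece_of _ Z c rfl hc
      have hle := hd₁.2.1.2.2 y' ⟨c, hc.symm⟩ hp
      have h₁ : y' <+: X₁ ++ Y₁ ++ Z₁ := ⟨c, hc.symm⟩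
      obtain ⟨d, hd'⟩ := List.prefix_of_prefix_length_le h₁ hd₁.2.1.1 hle
      exact ⟨d, hd'.symm⟩
    · exact absurd (piece_of _ (c ++ Z) [] (by simp [hc]) (by simp)) (hx.not_piece hC)
  subst hx₁
  have hs₁ : s = x₁ ++ Y₁ ++ (Z₁ ++ h) := by simpa using e
  -- `Z` is incomparable with the remainder of the occurrence
  have hinc₁ : ∀ c, x₁ ++ Y₁ ≠ Z ++ c := by
    intro c hc
    refine hy' (hd.piece_suffix_eq_nil hy (piece_of _ [] (c ++ Z₁) (by simp) ?_))
    have : y' ++ (x₁ ++ Y₁) ++ Z₁ = y' ++ (Z ++ c) ++ Z₁ := by rw [hc]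
    simpa using this
  have hinc₂ : ∀ c, Z ≠ x₁ ++ Y₁ ++ c := by
    intro c hc
    exact hd₁.not_piece_of_middle_factor (b := []) (a := y' ++ x₁) hC
      (piece_of _ c Z₁ (by simp [hc]) (by simp))
  have hinc : ∀ c d, Z ++ c ≠ x₁ ++ Y₁ ++ d := by
    intro c d hcd
    rcases List.append_eq_append_iff.1 hcd with ⟨c', hc, -⟩ | ⟨c', hc, -⟩
    · exact hinc₁ _ hc
    · exact hinc₂ _ hc
  rcases hs with rfl | ⟨a, u', v', X₂, Y₂, Z₂, s₂, hu, hv, -, hd₂, rfl⟩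
  · exact hinc _ _ hs₁
  obtain ⟨z, rfl⟩ : ∃ z, Z = a ++ z := by
    rcases List.append_eq_append_iff.1 hv with ⟨c, hc, -⟩ | ⟨c, hc, -⟩
    · refine absurd ?_ (hinc (c ++ (X₂ ++ Y₂ ++ s₂)) (Z₁ ++ h))
      rw [← hs₁, hu, hc]
      simp
    · exact ⟨c, hc⟩
  rw [hs₁] at hu
  obtain ⟨x₂, hx₂, hx₂'⟩ : ∃ x₂, x₁ ++ Y₁ = a ++ x₂ ∧ X₂ ++ Y₂ ++ s₂ = x₂ ++ (Z₁ ++ h) := by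
    rcases List.append_eq_append_iff.1 hu with ⟨c, hc, -⟩ | ⟨c, hc, hc'⟩
    · exact absurd (by rw [hc]; simp) (hinc [] (c ++ z))
    · exact ⟨c, hc, hc'⟩
  have hx₁' : y' ++ x₁ ++ Y₁ ++ Z₁ = (y' ++ a) ++ x₂ ++ Z₁ := by
    have : y' ++ (x₁ ++ Y₁) ++ Z₁ = y' ++ (a ++ x₂) ++ Z₁ := by rw [hx₂]
    simpa using this
  have hya : y' ++ a ≠ [] := by simp [hy']
  have hpa : Piece R (y' ++ a) := piece_of _ z (x₂ ++ Z₁) (by simp) (by simpa using hx₁')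
  have hpx₂ : Piece R x₂ := by
    rcases List.append_eq_append_iff.1 hx₂' with ⟨c, hc, -⟩ | ⟨c, hc, -⟩
    · have hp : Piece R (X₂ ++ Y₂ ++ []) := Piece.of_occurrences [] Z₂ (y' ++ a) (c ++ Z₁)
        hd₂.1 hx (by simp) (by rw [hx₁', hc]; simp) (Or.inr hya.symm)
      exact absurd hp (hd₂.not_piece_of_middle_factor hC)
    · exact Piece.of_occurrences [] (c ++ Z₂) (y' ++ a) Z₁ hd₂.1 hx (by rw [hc]; simp) hx₁'
        (Or.inr hya.symm)
  rw [hx₁'] at hx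
  exact hx.not_three_pieces hC hpa hpx₂ hd₁.2.2.2.1

/-- Position of a relation word `x` occurring in a word which begins with `X ++ Y`. -/
theorem occurrence_cases {X Y Z s l x h : List A} (hC : WeaklyC R 4) (hd : RelDecomp R X Y Z)
    (hx : RelWord R x) (e : X ++ Y ++ s = l ++ x ++ h) :
    (l = [] ∧ x = X ++ Y ++ Z) ∨ (∃ l', l = X ++ Y ++ l' ∧ s = l' ++ x ++ h) ∨
      ∃ y y', Y = y ++ y' ∧ y ≠ [] ∧ y' ≠ [] ∧ l = X ++ y ∧ y' ++ s = x ++ h := by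
  obtain ⟨X₁, Y₁, Z₁, rfl, hd₁⟩ := hx.exists_decomp hC
  have early : ∀ c, X = l ++ c → (l = [] ∧ X₁ ++ Y₁ ++ Z₁ = X ++ Y ++ Z) := by
    intro c hc
    have e' : c ++ Y ++ s = X₁ ++ Y₁ ++ (Z₁ ++ h) := by
      rw [hc] at e
      simpa using e
    obtain ⟨h₁, h₂⟩ := hd.eq_of_common_extension hC hd₁ hc (List.nil_append _).symm e'
    exact ⟨h₂, h₁.symm⟩
  rw [append_assoc, append_assoc] at e
  rcases List.append_eq_append_iff.1 e with ⟨y, hl, e₁⟩ | ⟨c, hc, -⟩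
  · by_cases hy : y = []
    · exact Or.inl (early [] (by simp [hl, hy]))
    rcases List.append_eq_append_iff.1 e₁ with ⟨l', hl', e₂⟩ | ⟨y', hy', e₂⟩
    · exact Or.inr (Or.inl ⟨l', by simp [hl, hl'], by simp [e₂]⟩)
    · by_cases hy₀ : y' = []
      · exact Or.inr (Or.inl ⟨[], by simp [hl, hy', hy₀], by simpa [hy₀] using e₂.symm⟩)
      · exact Or.inr (Or.inr ⟨y, y', hy', hy, hy₀, hl, e₂.symm⟩)
  · exact Or.inl (early c hc)

theorem RewriteChain.exists_prefix {N k : ℕ} {u v : List A} (hC : WeaklyC R 4)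
    (ih : ∀ j < N, ∀ u v, RewriteChain R j u v → AgreeOrSplit R u v)
    (h : RewriteChain R k u v) {j : ℕ} {X Y Z s t : List A} (hd : RelDecomp R X Y Z)
    (hu : u = X ++ Y ++ s) (hs : RewriteChain R j (Z ++ t) s) (hN : j + k ≤ N) :
    ∃ X Y Z s, RelDecomp R X Y Z ∧ v = X ++ Y ++ s := by
  induction h generalizing j X Y Z s t with
  | refl => exact ⟨X, Y, Z, s, hd, hu⟩
  | @head k u w v hstep hc ihk =>
    obtain ⟨l, r, x, y, hR, hu', hw⟩ := hstep
    have hx : RelWord R x := by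
      rcases hR with hR | hR
      · exact ⟨_, hR, Or.inl rfl⟩
      · exact ⟨_, hR, Or.inr rfl⟩
    have hy : RelWord R y := by
      rcases hR with hR | hR
      · exact ⟨_, hR, Or.inr rfl⟩
      · exact ⟨_, hR, Or.inl rfl⟩
    rcases occurrence_cases hC hd hx (hu.symm.trans hu') with
      ⟨rfl, -⟩ | ⟨l', rfl, rfl⟩ | ⟨y₁, y₂, h₁, h₂, h₃, -, h₅⟩
    · obtain ⟨X', Y', Z', rfl, hd'⟩ := hy.exists_decomp hC
      exact ihk (j := 0) (t := r) hd' (by simp [hw]) (.refl (Z' ++ r)) (by omega)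
    · exact ihk (j := j + 1) hd (by simp [hw]) (hs.snoc ⟨l', r, x, y, hR, rfl, rfl⟩) (by omega)
    · exact (no_occurrence_inside_middle hC hd h₁ h₂ h₃ hx h₅ (ih j (by omega) _ _ hs.symm)).elim

theorem RewriteChain.agreeOrSplit (hC : WeaklyC R 4) {n : ℕ} {u v : List A}
    (h : RewriteChain R n u v) : AgreeOrSplit R u v := by
  induction n using Nat.strong_induction_on generalizing u v with
  | _ n ihn =>
    induction u generalizing v with
    | nil =>
      rcases h.trichotomy with ⟨-, rfl⟩ | ⟨c, u', v', hu, -⟩ | ⟨x, t, i, hi, hx, hc⟩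
      · exact Or.inl rfl
      · simp at hu
      · obtain ⟨X, Y, Z, rfl, hd⟩ := hx.exists_decomp hC
        obtain ⟨X', Y', Z', s, hd', hs⟩ := hc.symm.exists_prefix hC (fun j hj u v => ihn j hj)
          hd (append_assoc _ _ _) (.refl (Z ++ t)) (by omega)
        exact Or.inr ⟨[], _, v, X', Y', Z', s, rfl, rfl, h.mequiv, hd', hs⟩
    | cons b u ihu =>
      rcases h.trichotomy with ⟨-, rfl⟩ | ⟨c, u', v', hu, rfl, hc⟩ | ⟨x, t, i, hi, hx, hc⟩
      · exact Or.inl rfl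
      · obtain ⟨rfl, rfl⟩ := List.cons.inj hu
        rcases ihu hc with rfl | ⟨a, u', v', X, Y, Z, s, rfl, rfl, he, hd, hs⟩
        · exact Or.inl rfl
        · exact Or.inr ⟨b :: a, u', v', X, Y, Z, s, rfl, rfl, he, hd, hs⟩
      · obtain ⟨X, Y, Z, rfl, hd⟩ := hx.exists_decomp hC
        obtain ⟨X', Y', Z', s, hd', hs⟩ := hc.symm.exists_prefix hC (fun j hj u v => ihn j hj)
          hd (append_assoc _ _ _) (.refl (Z ++ t)) (by omega)
        exact Or.inr ⟨[], _, v, X', Y', Z', s, rfl, rfl, h.mequiv, hd', hs⟩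

/-- A relation prefix of `p ++ u` starting in the piece `p` has its maximal piece prefix running
to or past the end of `p`. -/
theorem RelDecomp.exists_of_prefix_piece {p u a X Y Z s : List A} (hC : WeaklyC R 4)
    (hd : RelDecomp R X Y Z) (hp : Piece R (a ++ p)) (e : p ++ u = X ++ Y ++ s) :
    ∃ x, X = p ++ x ∧ u = x ++ Y ++ s := by
  have hp' : Piece R p := Piece.of_factor (a := a) (b := []) (by simpa using hp)
  rcases List.append_eq_append_iff.1 e with ⟨c, hc, hc'⟩ | ⟨c, hc, -⟩
  · have hpre : p <+: X ++ Y ++ Z := ⟨c ++ Z, by rw [hc]; simp⟩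
    obtain ⟨x, rfl⟩ := List.prefix_of_prefix_length_le hpre hd.2.1.1
      (hd.2.1.2.2 p hpre hp')
    exact ⟨x, rfl, by simpa using e⟩
  · rw [hc] at hp'
    exact absurd hp' (hd.not_piece_of_middle_factor hC)

end SmallOverlap

/-- Corollary 10: for a weakly `C(4)` finite monoid presentation,
let `p₁`, `p₂` be pieces with `p₁ ++ u ≡ p₁ ++ v` and `u` `p₂`-active.  Then
`p₂ ++ u ≡ p₂ ++ v`. -/
theorem active_transfer {A : Type*} [Fintype A] [DecidableEq A]
    (R : Finset (List A × List A)) (hC : WeaklyC R 4)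
    (p₁ p₂ u v : List A) (hp₁ : Piece R p₁) (hp₂ : Piece R p₂)
    (h : MEquiv R (p₁ ++ u) (p₁ ++ v)) (ha : PActive R p₂ u) :
    MEquiv R (p₂ ++ u) (p₂ ++ v) := by
  obtain ⟨a, X, Y, Z, hd, ⟨u', hu'⟩, hlt⟩ := ha
  obtain ⟨p, rfl⟩ : ∃ p, p₂ = a ++ p := by
    have hpre : a <+: p₂ ++ u := ⟨X ++ Y ++ u', by simpa using hu'⟩
    obtain ⟨p, hp⟩ := List.prefix_of_prefix_length_le hpre (List.prefix_append _ _) hlt.le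
    exact ⟨p, hp.symm⟩
  obtain ⟨x, hX, hux⟩ := hd.exists_of_prefix_piece hC hp₂ (u := u) (s := u')
    (by simpa using hu'.symm)
  obtain ⟨n, hn⟩ := h.exists_chain
  rcases hn.agreeOrSplit hC with he | ⟨b, w, w', X', Y', Z', s, hu, hv, he, hd', hw⟩
  · rw [List.append_cancel_left he]
    exact Relation.ReflTransGen.refl
  rcases List.append_eq_append_iff.1 hu with ⟨c, rfl, rfl⟩ | ⟨q, rfl, hq⟩
  · rw [append_assoc] at hv
    rw [List.append_cancel_left hv]
    exact (he.append_left c).append_left (a ++ p)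
  · rw [append_assoc] at hv
    have hv' : q ++ v = w' := List.append_cancel_left hv
    obtain ⟨x', hX', hux'⟩ := hd'.exists_of_prefix_piece hC hp₁ (hq.symm.trans hw)
    obtain ⟨-, rfl⟩ := hd.eq_of_common_extension hC hd' hX hX' (hux.symm.trans hux')
    rw [hq, ← hv'] at he
    simpa using he.append_left a
end

section
/- For a weakly C(4) finite monoid presentation ⟨A | R⟩: let XYZ be a relation word with maximal piece prefix X, middle word Y and maximal piece suffix Z, and let X̄ȲZ̄ and X̂ŶẐ be complements of XYZ (each factored into maximal piece prefix, middle word and maximal piece suffix). If X̄Ȳ is a prefix of X̂Ŷ, then X̄Ȳ = X̂Ŷ; that is, no complement of XY is a proper prefix of another complement of XY. -/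
open List

/-- for a weakly `C(4)` finite monoid presentation, no complement
`X̄Ȳ` of `XY` is a proper prefix of another complement `X̂Ŷ` of `XY`. -/
theorem complement_prefix_eq {A : Type*} [Fintype A] [DecidableEq A]
    (R : Finset (List A × List A)) (hC : WeaklyC R 4)
    (X Y Z X₁ Y₁ Z₁ X₂ Y₂ Z₂ : List A)
    (hd : RelDecomp R X Y Z)
    (h₁ : RelComplement R (X ++ Y ++ Z) (X₁ ++ Y₁ ++ Z₁)) (hd₁ : RelDecomp R X₁ Y₁ Z₁)
    (h₂ : RelComplement R (X ++ Y ++ Z) (X₂ ++ Y₂ ++ Z₂)) (hd₂ : RelDecomp R X₂ Y₂ Z₂)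
    (hpre : (X₁ ++ Y₁) <+: (X₂ ++ Y₂)) :
    X₁ ++ Y₁ = X₂ ++ Y₂ := by
  obtain ⟨hw₁, -, hZ₁⟩ := hd₁
  obtain ⟨hw₂, -, hZ₂⟩ := hd₂
  by_cases h : X₁ ++ Y₁ ++ Z₁ = X₂ ++ Y₂ ++ Z₂
  · have hle₁ := hZ₁.2.2 Z₂ (h ▸ hZ₂.1) hZ₂.2.1
    have hle₂ := hZ₂.2.2 Z₁ (h ▸ hZ₁.1) hZ₁.2.1
    exact (List.append_inj' h (le_antisymm hle₂ hle₁)).1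
  · obtain ⟨t, ht⟩ := hpre
    have hp : Piece R (X₁ ++ Y₁) :=
      Or.inr ⟨_, _, [], Z₁, [], t ++ Z₂, hw₁, hw₂, by simp, by simp [← ht], Or.inl h⟩
    have hlen := hC _ hw₁ [X₁ ++ Y₁, Z₁] (by simp [hp, hZ₁.2.1]) (by simp)
    simp at hlen
end

section
/- For a weakly C(3) finite monoid presentation ⟨A | R⟩: if a word u has a relation prefix, then the shortest relation prefix of u is an overlap prefix of u. -/
open List

/-- for a weakly `C(3)` finite monoid presentation, if a word `u` has
a relation prefix, then its shortest relation prefix is an overlap prefix. -/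
theorem shortest_relPrefix_is_overlapPrefix {A : Type*} [Fintype A] [DecidableEq A]
    (R : Finset (List A × List A)) (hC : WeaklyC R 3)
    (u q : List A) (hq : RelPrefix R u q)
    (hmin : ∀ q', RelPrefix R u q' → q.length ≤ q'.length) :
    ∃ a X Y, q = a ++ X ++ Y ∧ OPrefix R u a X Y := by
  classical
  obtain ⟨hqu, a₀, X₀, Y₀, Z₀, hq₀, hD₀⟩ := hq
  -- Among the relation factors `X Y` ending at the end of `q`, choose the one starting leftmost.
  have hex : ∃ k, ∃ a X Y Z, a.length = k ∧ q = a ++ X ++ Y ∧ RelDecomp R X Y Z :=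
    ⟨_, a₀, X₀, Y₀, Z₀, rfl, hq₀, hD₀⟩
  obtain ⟨a, X, Y, Z, hlen, hqa, hD⟩ := Nat.find_spec hex
  refine ⟨a, X, Y, hqa, hqa ▸ hqu, a, 1, fun _ => X, fun _ => Y, fun _ => Z, fun _ => [],
    le_rfl, rfl, rfl, by simp, fun _ _ => hD, fun i hi => by simp at hi, ?_⟩
  rintro ⟨c, d, X₁, Y₁, Z₁, hD₁, heq, hlt⟩
  rw [← hqa] at heq
  have hle := hmin (c ++ X₁ ++ Y₁)
    ⟨(heq ▸ List.prefix_append _ d : c ++ X₁ ++ Y₁ <+: q).trans hqu, c, X₁, Y₁, Z₁, rfl, hD₁⟩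
  have hd : d = [] := by
    have := congrArg List.length heq
    simp only [List.length_append] at this hle
    exact List.length_eq_zero_iff.mp (by omega)
  subst hd
  exact Nat.find_min hex (hlen ▸ hlt) ⟨c, X₁, Y₁, Z₁, rfl, by simpa using heq, hD₁⟩
end
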